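/- Let P₁, …, P_m be complex N×N Hermitian matrices such that P_k² = I, trace(P_k) = 0 for every k, and P_j P_k = −P_k P_j for all j ≠ k. Let c = (c₁, …, c_m) be a nonzero real vector, δ a real number, and H := δ·I + Σ_{k=1}^m c_k P_k. Then the spectrum of H is exactly {δ + ‖c‖₂, δ − ‖c‖₂}, and δ − ‖c‖₂ is the least eigenvalue of H. (This is the noncontextual energy formula E±(ν) = δ(ν) ± ‖c(ν)‖₂ for each symmetry block of a noncontextual Pauli Hamiltonian.) -/

import Mathlib

open Matrix BigOperators

/-- The square of a linear combination of pairwise anticommuting involutions is the scalar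
given by the sum of the squares of the coefficients. -/
lemma sum_smul_mul_self_of_anticommute {ι K A : Type*} [Fintype ι] [Field K] [CharZero K]
    [Ring A] [Algebra K A] (P : ι → A) (hsq : ∀ k, P k * P k = 1)
    (hanti : ∀ j k, j ≠ k → P j * P k = -(P k * P j)) (c : ι → K) :
    (∑ k, c k • P k) * (∑ k, c k • P k) = (∑ k, c k ^ 2) • (1 : A) := by
  classical
  have expand : (∑ k, c k • P k) * (∑ k, c k • P k) =
      ∑ j, ∑ k, (c j * c k) • (P j * P k) := by
    simp only [Finset.sum_mul_sum, smul_mul_smul_comm]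
  have swap : ∑ j, ∑ k, (c j * c k) • (P j * P k) = ∑ j, ∑ k, (c j * c k) • (P k * P j) := by
    rw [Finset.sum_comm]
    exact Finset.sum_congr rfl fun j _ => Finset.sum_congr rfl fun k _ => by rw [mul_comm (c k)]
  have pair (j k : ι) : (c j * c k) • (P j * P k) + (c j * c k) • (P k * P j) =
      if j = k then ((2 : K) * c j ^ 2) • (1 : A) else 0 := by
    split_ifs with h
    · subst h
      rw [hsq, ← add_smul]
      ring_nf
    · rw [hanti j k h, smul_neg, neg_add_cancel]
  have double : (2 : K) • ((∑ k, c k • P k) * (∑ k, c k • P k)) =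
      (2 : K) • ((∑ k, c k ^ 2) • (1 : A)) := by
    rw [two_smul, expand]
    nth_rewrite 2 [swap]
    simp only [← Finset.sum_add_distrib, pair, Finset.sum_ite_eq, Finset.mem_univ, if_true,
      ← Finset.sum_smul, ← Finset.mul_sum, smul_smul]
  exact smul_right_injective A (two_ne_zero : (2 : K) ≠ 0) double

/-- A spectral value of an element whose square is the scalar `s` squares to `s`. -/
lemma sq_eq_of_mem_spectrum_of_mul_self {K A : Type*} [Field K] [Ring A] [Algebra K A]
    {a : A} {s μ : K} (h : a * a = s • (1 : A)) (hμ : μ ∈ spectrum K a) : μ ^ 2 = s := by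
  have : Nontrivial A := by
    by_contra hA
    rw [not_nontrivial_iff_subsingleton] at hA
    simp [spectrum.of_subsingleton] at hμ
  have hpow := spectrum.pow_mem_pow a 2 hμ
  rwa [pow_two a, h, ← Algebra.algebraMap_eq_smul_one, spectrum.scalar_eq,
    Set.mem_singleton_iff] at hpow

/-- A nonzero square root of the scalar square of a traceless matrix is a spectral value. -/
lemma Matrix.mem_spectrum_of_mul_self_of_trace_eq_zero {n K : Type*} [Fintype n] [DecidableEq n]
    [Nonempty n] [Field K] [CharZero K] {A : Matrix n n K} {r : K} (hr : r ≠ 0)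
    (h : A * A = (r ^ 2) • (1 : Matrix n n K)) (htr : A.trace = 0) : r ∈ spectrum K A := by
  rw [spectrum.mem_iff, Algebra.algebraMap_eq_smul_one]
  intro hu
  have hprod : (r • (1 : Matrix n n K) - A) * (r • (1 : Matrix n n K) + A) = 0 := by
    simp only [sub_mul, mul_add, smul_mul_assoc, mul_smul_comm, one_mul, mul_one, h, smul_sub,
      smul_smul, pow_two]
    abel
  have htrace := congrArg Matrix.trace (hu.mul_right_eq_zero.mp hprod)
  simp [htr, hr] at htrace

/-- The spectrum of a traceless matrix whose square is a nonzero scalar `r ^ 2`. -/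
lemma Matrix.spectrum_eq_of_mul_self_of_trace_eq_zero {n K : Type*} [Fintype n] [DecidableEq n]
    [Nonempty n] [Field K] [CharZero K] {A : Matrix n n K} {r : K} (hr : r ≠ 0)
    (h : A * A = (r ^ 2) • (1 : Matrix n n K)) (htr : A.trace = 0) :
    spectrum K A = {r, -r} := by
  ext μ
  rw [Set.mem_insert_iff, Set.mem_singleton_iff]
  refine ⟨fun hμ => sq_eq_sq_iff_eq_or_eq_neg.mp (sq_eq_of_mem_spectrum_of_mul_self h hμ), ?_⟩
  rintro (rfl | rfl)
  · exact mem_spectrum_of_mul_self_of_trace_eq_zero hr h htr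
  · exact mem_spectrum_of_mul_self_of_trace_eq_zero (neg_ne_zero.mpr hr) (by rwa [neg_sq]) htr

/-- Noncontextual energy formula: for `H = δ • 1 + ∑ c k • P k` with `P k` pairwise
anticommuting Hermitian traceless involutions and `c ≠ 0`, the spectrum of `H` is
exactly `{δ + ‖c‖₂, δ - ‖c‖₂}`, and `δ - ‖c‖₂` is the least eigenvalue. -/
theorem noncontextual_block_spectrum {N m : ℕ} (hN : 0 < N)
    (P : Fin m → Matrix (Fin N) (Fin N) ℂ)
    (hherm : ∀ k, (P k).IsHermitian)
    (hsq : ∀ k, P k * P k = 1)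
    (htr : ∀ k, (P k).trace = 0)
    (hanti : ∀ j k, j ≠ k → P j * P k = -(P k * P j))
    (c : Fin m → ℝ) (hc : c ≠ 0) (δ : ℝ) :
    spectrum ℂ ((δ : ℂ) • (1 : Matrix (Fin N) (Fin N) ℂ) + ∑ k, (c k : ℂ) • P k)
        = {((δ + Real.sqrt (∑ k, (c k) ^ 2) : ℝ) : ℂ),
           ((δ - Real.sqrt (∑ k, (c k) ^ 2) : ℝ) : ℂ)} ∧
    ∀ μ : ℝ, (μ : ℂ) ∈ spectrum ℂ
        ((δ : ℂ) • (1 : Matrix (Fin N) (Fin N) ℂ) + ∑ k, (c k : ℂ) • P k) →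
      δ - Real.sqrt (∑ k, (c k) ^ 2) ≤ μ := by
  have : Nonempty (Fin N) := ⟨⟨0, hN⟩⟩
  obtain ⟨i, hi⟩ := Function.ne_iff.mp hc
  have hpos : 0 < ∑ k, (c k) ^ 2 :=
    Finset.sum_pos' (fun k _ => sq_nonneg (c k)) ⟨i, Finset.mem_univ i, sq_pos_of_ne_zero hi⟩
  set r := Real.sqrt (∑ k, (c k) ^ 2) with hr
  have hr_pos : 0 < r := Real.sqrt_pos.mpr hpos
  have hr_sq : (r : ℂ) ^ 2 = ∑ k, (c k : ℂ) ^ 2 := by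
    exact_mod_cast Real.sq_sqrt hpos.le
  have hspec : spectrum ℂ (∑ k, (c k : ℂ) • P k) = {(r : ℂ), -(r : ℂ)} := by
    apply Matrix.spectrum_eq_of_mul_self_of_trace_eq_zero (by exact_mod_cast hr_pos.ne')
    · rw [hr_sq, sum_smul_mul_self_of_anticommute P hsq hanti]
    · simp [Matrix.trace_sum, htr]
  have hshift : spectrum ℂ ((δ : ℂ) • (1 : Matrix (Fin N) (Fin N) ℂ) + ∑ k, (c k : ℂ) • P k)
      = {((δ + r : ℝ) : ℂ), ((δ - r : ℝ) : ℂ)} := by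
    rw [← Algebra.algebraMap_eq_smul_one, ← spectrum.singleton_add_eq, hspec]
    simp [Set.image_pair, sub_eq_add_neg]
  refine ⟨hshift, fun μ hμ => ?_⟩
  rw [hshift, Set.mem_insert_iff, Set.mem_singleton_iff, Complex.ofReal_inj,
    Complex.ofReal_inj] at hμ
  rcases hμ with rfl | rfl <;> linarith
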